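/- Let t ≥ 1 and let F_0 = {∅} ∪ { F ⊆ [2t+1] : |F| = t } ∪ { F ⊆ [2t+1] : |F| = t+1 and 2t+1 ∈ F } ∪ { F ⊆ [2t] : |F| = t+2 }, and let F = F_0 ∪ { [n] \ F : F ∈ F_0 } as a family of subsets of [n] with n ≥ 2t+2. Then F does not contain an induced copy of (binom(2t,t)+1) C_2; that is, there are no sets B_1 ⊆ T_1, ..., B_m ⊆ T_m in F with m = binom(2t,t)+1 and B_i ⊄ T_j for all i ≠ j. -/

import Mathlib

/-- The family `F_0` of the construction for `(binom(2t,t)+1) C_2`. -/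
def famF0 (t : ℕ) : Set (Finset ℕ) :=
  {∅} ∪ {F | F ⊆ Finset.Icc 1 (2 * t + 1) ∧ F.card = t}
    ∪ {F | F ⊆ Finset.Icc 1 (2 * t + 1) ∧ F.card = t + 1 ∧ 2 * t + 1 ∈ F}
    ∪ {F | F ⊆ Finset.Icc 1 (2 * t) ∧ F.card = t + 2}

/-- `F = F_0 ∪ F_0^c` as subsets of `[n]`. -/
def famF (t n : ℕ) : Set (Finset ℕ) :=
  famF0 t ∪ ((fun F => Finset.Icc 1 n \ F) '' famF0 t)

/-- Triangular system of vectors over `ZMod 2`: a bound on the number of indices. -/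
theorem tri_bound {m : ℕ} {ι : Type*} [Fintype ι] (p q : Fin m → ι → ZMod 2) (r : Fin m → ℕ)
    (hd : ∀ i, ∑ R, p i R * q i R = 1)
    (ho : ∀ i j, i ≠ j → r i ≤ r j → ∑ R, p i R * q j R = 0) : m ≤ Fintype.card ι := by
  have hli : LinearIndependent (ZMod 2) p := by
    rw [Fintype.linearIndependent_iff]
    intro c hc
    by_contra hne
    push Not at hne
    obtain ⟨i0, hi0⟩ := hne
    obtain ⟨j, hj, hmax⟩ := Finset.exists_max_image (Finset.univ.filter fun i => c i ≠ 0) r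
      ⟨i0, by simpa using hi0⟩
    have hj' : c j ≠ 0 := by simpa using hj
    have h1 : ∑ R, (∑ i, c i • p i) R * q j R = 0 := by rw [hc]; simp
    have h2 : ∑ R, (∑ i, c i • p i) R * q j R = ∑ i, c i * ∑ R, p i R * q j R := by
      simp only [Finset.sum_apply, Pi.smul_apply, smul_eq_mul, Finset.sum_mul, Finset.mul_sum]
      rw [Finset.sum_comm]
      simp only [mul_assoc]
    rw [h2, Finset.sum_eq_single j] at h1
    · rw [hd, mul_one] at h1
      exact hj' h1
    · intro i _ hij
      by_cases hci : c i = 0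
      · simp [hci]
      · rw [ho i j hij (hmax i (by simpa using hci)), mul_zero]
    · simp
  have := hli.fintype_card_le_finrank
  simpa using this

theorem between_two {t : ℕ} {U a u : Finset ℕ} (hau : a ⊆ u) (hu : u ⊆ U)
    (h1 : a.card + 1 = t) (h2 : u.card = t + 1) :
    ((Finset.powersetCard t U).filter fun R => a ⊆ R ∧ R ⊆ u).card = 2 := by
  have : ((Finset.powersetCard t U).filter fun R => a ⊆ R ∧ R ⊆ u)
      = (u \ a).image (fun z => insert z a) := by
    ext R
    simp only [Finset.mem_filter, Finset.mem_powersetCard, Finset.mem_image, Finset.mem_sdiff]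
    constructor
    · rintro ⟨⟨_, hc⟩, haR, hRu⟩
      have hcard : (R \ a).card = 1 := by
        rw [Finset.card_sdiff_of_subset haR]; omega
      obtain ⟨z, hz⟩ := Finset.card_eq_one.1 hcard
      have hz' : z ∈ R \ a := by rw [hz]; simp
      rw [Finset.mem_sdiff] at hz'
      refine ⟨z, ⟨hRu hz'.1, hz'.2⟩, ?_⟩
      rw [Finset.insert_eq, ← hz, Finset.sdiff_union_of_subset haR]
    · rintro ⟨z, ⟨hzu, hza⟩, rfl⟩
      have h3 : insert z a ⊆ u := Finset.insert_subset hzu hau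
      refine ⟨⟨h3.trans hu, ?_⟩, Finset.subset_insert _ _, h3⟩
      rw [Finset.card_insert_of_notMem hza]; omega
  rw [this, Finset.card_image_of_injOn, Finset.card_sdiff_of_subset hau]
  · omega
  · intro z hz w hw h
    simp only [Finset.coe_sdiff, Set.mem_sdiff, Finset.mem_coe] at hz hw
    have : z ∈ insert w a := by
      have h' : insert z a = insert w a := h
      rw [← h']; simp
    rcases Finset.mem_insert.1 this with h | h
    · exact h
    · exact absurd h hz.2

theorem between_one {t : ℕ} {U a u : Finset ℕ} (hau : a ⊆ u) (hu : u ⊆ U)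
    (h1 : a.card ≤ t) (h2 : t ≤ u.card) (h : a.card = t ∨ u.card = t) :
    ((Finset.powersetCard t U).filter fun R => a ⊆ R ∧ R ⊆ u).card = 1 := by
  rw [Finset.card_eq_one]
  rcases h with h | h
  · refine ⟨a, ?_⟩
    ext R
    simp only [Finset.mem_filter, Finset.mem_powersetCard, Finset.mem_singleton]
    constructor
    · rintro ⟨⟨_, hc⟩, haR, hRu⟩
      exact (Finset.eq_of_subset_of_card_le haR (by omega)).symm
    · rintro rfl
      exact ⟨⟨hau.trans hu, h⟩, subset_rfl, hau⟩
  · refine ⟨u, ?_⟩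
    ext R
    simp only [Finset.mem_filter, Finset.mem_powersetCard, Finset.mem_singleton]
    constructor
    · rintro ⟨⟨_, hc⟩, haR, hRu⟩
      exact Finset.eq_of_subset_of_card_le hRu (by omega)
    · rintro rfl
      exact ⟨⟨hu, h⟩, hau, subset_rfl⟩

/-- The combinatorial bound. -/
theorem comb_bound {m t : ℕ} (U : Finset ℕ) (a u : Fin m → Finset ℕ) (r : Fin m → ℕ)
    (hau : ∀ i, a i ⊆ u i) (hu : ∀ i, u i ⊆ U)
    (h1 : ∀ i, (a i).card ≤ t) (h2 : ∀ i, t ≤ (u i).card)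
    (h : ∀ i, (a i).card = t ∨ (u i).card = t)
    (ho : ∀ i j, i ≠ j → r i ≤ r j → a i ⊆ u j → (a i).card + 1 = t ∧ (u j).card = t + 1) :
    m ≤ U.card.choose t := by
  have key : ∀ i j, ∑ R : (Finset.powersetCard t U),
      (if a i ⊆ (R : Finset ℕ) then (1 : ZMod 2) else 0) *
        (if (R : Finset ℕ) ⊆ u j then (1 : ZMod 2) else 0)
      = (((Finset.powersetCard t U).filter fun R => a i ⊆ R ∧ R ⊆ u j).card : ZMod 2) := by
    intro i j
    rw [Finset.sum_coe_sort (Finset.powersetCard t U)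
      (fun R => (if a i ⊆ R then (1 : ZMod 2) else 0) * (if R ⊆ u j then (1 : ZMod 2) else 0))]
    rw [Finset.card_filter]
    push_cast
    refine Finset.sum_congr rfl fun R _ => ?_
    by_cases hx : a i ⊆ R <;> by_cases hy : R ⊆ u j <;> simp [hx, hy]
  have := tri_bound (m := m) (ι := (Finset.powersetCard t U))
    (fun i R => if a i ⊆ (R : Finset ℕ) then 1 else 0)
    (fun j R => if (R : Finset ℕ) ⊆ u j then 1 else 0) r
    (fun i => by
      rw [key, between_one (hau i) (hu i) (h1 i) (h2 i) (h i)]; simp)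
    (fun i j hij hr => by
      rw [key]
      by_cases hs : a i ⊆ u j
      · obtain ⟨h3, h4⟩ := ho i j hij hr hs
        rw [between_two hs (hu j) h3 h4]; rfl
      · rw [Finset.filter_false_of_mem]
        · simp
        · rintro R _ ⟨hx, hy⟩
          exact hs (hx.trans hy))
  simpa using this

theorem famF0_cases {t : ℕ} {F : Finset ℕ} (h : F ∈ famF0 t) :
    F = ∅ ∨ (F ⊆ Finset.Icc 1 (2 * t + 1) ∧ (F.card = t ∨ (F.card = t + 1 ∧ 2 * t + 1 ∈ F)
      ∨ (F.card = t + 2 ∧ 2 * t + 1 ∉ F))) := by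
  simp only [famF0, Set.mem_union, Set.mem_singleton_iff, Set.mem_ofPred_eq] at h
  rcases h with ((h | h) | h) | h
  · exact Or.inl h
  · exact Or.inr ⟨h.1, Or.inl h.2⟩
  · exact Or.inr ⟨h.1, Or.inr (Or.inl h.2)⟩
  · refine Or.inr ⟨h.1.trans (Finset.Icc_subset_Icc le_rfl (by omega)), Or.inr (Or.inr ⟨h.2, ?_⟩)⟩
    intro hx
    have := Finset.mem_Icc.1 (h.1 hx)
    omega

/-- The four kinds of pairs. -/
def Kind (t n : ℕ) (B T : Finset ℕ) (r : ℕ) (a u : Finset ℕ) : Prop :=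
  (r = 0 ∧ B ⊆ Finset.Icc 1 (2 * t) ∧ B.card = t ∧ a = B ∧ u = B) ∨
  (r = 1 ∧ 2 * t + 1 ∈ B ∧ B ⊆ T ∧ T ⊆ Finset.Icc 1 (2 * t + 1) ∧ B.card = t ∧ T.card = t + 1 ∧
    a = B.erase (2 * t + 1) ∧ u = T.erase (2 * t + 1)) ∨
  (r = 2 ∧ ∃ D E, D ⊆ E ∧ E ⊆ Finset.Icc 1 (2 * t + 1) ∧ 2 * t + 1 ∈ D ∧ D.card = t ∧
    E.card = t + 1 ∧ B = Finset.Icc 1 n \ E ∧ T = Finset.Icc 1 n \ D ∧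
    a = Finset.Icc 1 (2 * t) \ E ∧ u = Finset.Icc 1 (2 * t) \ D) ∨
  (r = 3 ∧ B ⊆ T ∧ ∃ D, D ⊆ Finset.Icc 1 (2 * t) ∧ D.card = t ∧ T = Finset.Icc 1 n \ D ∧
    a = Finset.Icc 1 (2 * t) \ D ∧ u = Finset.Icc 1 (2 * t) \ D)

theorem sub_of_notMem {t : ℕ} {F : Finset ℕ} (h : F ⊆ Finset.Icc 1 (2 * t + 1))
    (hx : 2 * t + 1 ∉ F) : F ⊆ Finset.Icc 1 (2 * t) := by
  intro y hy
  have := Finset.mem_Icc.1 (h hy)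
  have : y ≠ 2 * t + 1 := fun e => hx (e ▸ hy)
  rw [Finset.mem_Icc]; omega

theorem exists_kind {t n : ℕ} (hn : 2 * t + 2 ≤ n) {B T : Finset ℕ}
    (hB : B ∈ famF t n) (hT : T ∈ famF t n) (hBT : B ⊂ T) (hB0 : B ≠ ∅)
    (hTn : T ≠ Finset.Icc 1 n) : ∃ r a u, Kind t n B T r a u := by
  have hlt := Finset.card_lt_card hBT
  have hsub := hBT.subset
  rcases hB with hB | ⟨E, hE, rfl⟩
  · rcases famF0_cases hB with h | ⟨hBs, hBc⟩
    · exact absurd h hB0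
    rcases hT with hT | ⟨D, hD, rfl⟩
    · rcases famF0_cases hT with h | ⟨hTs, hTc⟩
      · subst h; simp at hlt
      by_cases hx : 2 * t + 1 ∈ B
      · have hxT := hsub hx
        have h1 : B.card = t ∧ T.card = t + 1 := by
          simp only [hx, hxT, not_true_eq_false, and_false, or_false, and_true] at hBc hTc
          omega
        exact ⟨1, _, _, Or.inr (Or.inl ⟨rfl, hx, hsub, hTs, h1.1, h1.2, rfl, rfl⟩)⟩
      · have h1 : B.card = t := by
          simp only [hx, not_false_eq_true, and_false, false_or, and_true] at hBc
          omega
        exact ⟨0, _, _, Or.inl ⟨rfl, sub_of_notMem hBs hx, h1, rfl, rfl⟩⟩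
    · simp only at *
      rcases famF0_cases hD with h | ⟨hDs, hDc⟩
      · subst h; simp at hTn
      have hdis : Disjoint B D := by
        rw [Finset.disjoint_left]
        intro y hy hyD
        exact (Finset.mem_sdiff.1 (hsub hy)).2 hyD
      have hcard : B.card + D.card ≤ 2 * t + 1 := by
        rw [← Finset.card_union_of_disjoint hdis]
        simpa using Finset.card_le_card (Finset.union_subset hBs hDs)
      by_cases hxD : 2 * t + 1 ∈ D
      · have hx : 2 * t + 1 ∉ B := fun h => Finset.disjoint_left.1 hdis h hxD
        have h1 : B.card = t := by
          simp only [hx, not_false_eq_true, and_false, false_or, and_true] at hBc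
          omega
        exact ⟨0, _, _, Or.inl ⟨rfl, sub_of_notMem hBs hx, h1, rfl, rfl⟩⟩
      · have h1 : D.card = t := by
          simp only [hxD, not_false_eq_true, and_false, false_or, and_true] at hDc
          omega
        exact ⟨3, _, _, Or.inr (Or.inr (Or.inr
          ⟨rfl, hsub, D, sub_of_notMem hDs hxD, h1, rfl, rfl, rfl⟩))⟩
  · simp only at *
    have hEs : E ⊆ Finset.Icc 1 (2 * t + 1) := by
      rcases famF0_cases hE with h | h
      · simp [h]
      · exact h.1
    rcases hT with hT | ⟨D, hD, rfl⟩
    · exfalso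
      have hTs : T ⊆ Finset.Icc 1 (2 * t + 1) := by
        rcases famF0_cases hT with h | h
        · simp [h]
        · exact h.1
      have h1 : 2 * t + 2 ∈ Finset.Icc 1 n \ E := by
        rw [Finset.mem_sdiff, Finset.mem_Icc]
        refine ⟨by omega, fun h => ?_⟩
        have := Finset.mem_Icc.1 (hEs h)
        omega
      have := Finset.mem_Icc.1 (hTs (hsub h1))
      omega
    · simp only at *
      rcases famF0_cases hD with h | ⟨hDs, hDc⟩
      · subst h; simp at hTn
      have hDn : D ⊆ Finset.Icc 1 n := hDs.trans (Finset.Icc_subset_Icc le_rfl (by omega))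
      have hEn : E ⊆ Finset.Icc 1 n := hEs.trans (Finset.Icc_subset_Icc le_rfl (by omega))
      have hDE : D ⊆ E := by
        intro y hy
        by_contra hyE
        exact (Finset.mem_sdiff.1 (hsub (Finset.mem_sdiff.2 ⟨hDn hy, hyE⟩))).2 hy
      have hlt' : D.card < E.card := by
        rw [Finset.card_sdiff_of_subset hDn, Finset.card_sdiff_of_subset hEn] at hlt
        omega
      by_cases hxD : 2 * t + 1 ∈ D
      · have hxE := hDE hxD
        rcases famF0_cases hE with h | ⟨_, hEc⟩
        · subst h; simp at hxE
        have h1 : D.card = t ∧ E.card = t + 1 := by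
          simp only [hxD, hxE, not_true_eq_false, and_false, or_false, and_true] at hDc hEc
          omega
        exact ⟨2, _, _, Or.inr (Or.inr (Or.inl
          ⟨rfl, D, E, hDE, hEs, hxD, h1.1, h1.2, rfl, rfl, rfl, rfl⟩))⟩
      · have h1 : D.card = t := by
          simp only [hxD, not_false_eq_true, and_false, false_or, and_true] at hDc
          rcases famF0_cases hE with h | ⟨_, hEc⟩
          · subst h; simp at hlt'
          · omega
        exact ⟨3, _, _, Or.inr (Or.inr (Or.inr
          ⟨rfl, hsub, D, sub_of_notMem hDs hxD, h1, rfl, rfl, rfl⟩))⟩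

theorem sdiff_x {t : ℕ} {D : Finset ℕ} (hx : 2 * t + 1 ∈ D) :
    Finset.Icc 1 (2 * t) \ D = Finset.Icc 1 (2 * t + 1) \ D := by
  ext y
  simp only [Finset.mem_sdiff, Finset.mem_Icc]
  constructor
  · rintro ⟨h, h'⟩; exact ⟨by omega, h'⟩
  · rintro ⟨h, h'⟩
    have : y ≠ 2 * t + 1 := fun e => h' (e ▸ hx)
    exact ⟨by omega, h'⟩

theorem Kind.props {t n : ℕ} {B T a u : Finset ℕ} {r : ℕ} (ht : 1 ≤ t) (h : Kind t n B T r a u) :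
    a ⊆ u ∧ u ⊆ Finset.Icc 1 (2 * t) ∧ (a.card = t ∨ a.card + 1 = t) ∧
      (u.card = t ∨ u.card = t + 1) ∧ (a.card = t ∨ u.card = t) ∧
      (r = 1 ∨ a.card = t) ∧ (r = 2 ∨ u.card = t) ∧
      (r = 1 → a.card + 1 = t) ∧ (r = 2 → u.card = t + 1) := by
  rcases h with ⟨rfl, h1, h2, rfl, rfl⟩ | ⟨rfl, h1, h2, h3, h4, h5, rfl, rfl⟩ |
    ⟨rfl, D, E, h1, h2, h3, h4, h5, rfl, rfl, rfl, rfl⟩ | ⟨rfl, h0, D, h1, h2, rfl, rfl, rfl⟩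
  · exact ⟨subset_rfl, h1, by omega, by omega, by omega, by omega, by omega, by omega, by omega⟩
  · have e1 := Finset.card_erase_of_mem h1
    have e2 := Finset.card_erase_of_mem (h2 h1)
    refine ⟨Finset.erase_subset_erase _ h2, sub_of_notMem ((Finset.erase_subset _ _).trans h3)
      (Finset.notMem_erase _ _), by omega, by omega, by omega, by omega, by omega, by omega,
      by omega⟩
  · have e1 : (Finset.Icc 1 (2 * t) \ E).card = t := by
      rw [sdiff_x (h1 h3), Finset.card_sdiff_of_subset h2]; simp; omega
    have e2 : (Finset.Icc 1 (2 * t) \ D).card = t + 1 := by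
      rw [sdiff_x h3, Finset.card_sdiff_of_subset (h1.trans h2)]; simp; omega
    refine ⟨Finset.sdiff_subset_sdiff subset_rfl h1, Finset.sdiff_subset, by omega, by omega,
      by omega, by omega, by omega, by omega, by omega⟩
  · have e1 : (Finset.Icc 1 (2 * t) \ D).card = t := by
      rw [Finset.card_sdiff_of_subset h1]; simp; omega
    refine ⟨subset_rfl, Finset.sdiff_subset, by omega, by omega,
      by omega, by omega, by omega, by omega, by omega⟩

theorem Kind.pair {t n : ℕ} (hn : 2 * t + 2 ≤ n) {B T a u B' T' a' u' : Finset ℕ} {r r' : ℕ}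
    (ht : 1 ≤ t) (h : Kind t n B T r a u) (h' : Kind t n B' T' r' a' u')
    (hBT' : B' ⊆ T') (hr : r ≤ r')
    (hs : a ⊆ u') : B ⊆ T' ∨ (r = 1 ∧ r' = 2) := by
  have hp := h.props ht
  have hp' := h'.props ht
  by_cases hrr : r = 1 ∧ r' = 2
  · exact Or.inr hrr
  left
  have hT0 : u' ⊆ T' := by
    rcases h' with ⟨rfl, h1, h2, rfl, rfl⟩ | ⟨rfl, h1, h2, h3, h4, h5, rfl, rfl⟩ |
      ⟨rfl, D, E, h1, h2, h3, h4, h5, rfl, rfl, rfl, rfl⟩ | ⟨rfl, h0, D, h1, h2, rfl, rfl, rfl⟩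
    · exact hBT'
    · exact Finset.erase_subset _ _
    · exact Finset.sdiff_subset_sdiff (Finset.Icc_subset_Icc le_rfl (by omega)) subset_rfl
    · exact Finset.sdiff_subset_sdiff (Finset.Icc_subset_Icc le_rfl (by omega)) subset_rfl
  have hT1 : r' = 1 ∨ r' = 3 → 2 * t + 1 ∈ T' := by
    rcases h' with ⟨rfl, h1, h2, rfl, rfl⟩ | ⟨rfl, h1, h2, h3, h4, h5, rfl, rfl⟩ |
      ⟨rfl, D, E, h1, h2, h3, h4, h5, rfl, rfl, rfl, rfl⟩ | ⟨rfl, h0, D, h1, h2, rfl, rfl, rfl⟩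
    · intro h; omega
    · intro _; exact h2 h1
    · intro h; omega
    · intro _
      rw [Finset.mem_sdiff, Finset.mem_Icc]
      refine ⟨by omega, fun h => ?_⟩
      have := Finset.mem_Icc.1 (h1 h)
      omega
  have hT2 : r' = 2 ∨ r' = 3 → ∃ D, D ⊆ Finset.Icc 1 (2 * t + 1) ∧ T' = Finset.Icc 1 n \ D ∧
      u' = Finset.Icc 1 (2 * t) \ D := by
    rcases h' with ⟨rfl, h1, h2, rfl, rfl⟩ | ⟨rfl, h1, h2, h3, h4, h5, rfl, rfl⟩ |
      ⟨rfl, D, E, h1, h2, h3, h4, h5, rfl, rfl, rfl, rfl⟩ | ⟨rfl, h0, D, h1, h2, rfl, rfl, rfl⟩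
    · intro h; omega
    · intro h; omega
    · intro _; exact ⟨D, h1.trans h2, rfl, rfl⟩
    · intro _
      exact ⟨D, h1.trans (Finset.Icc_subset_Icc le_rfl (by omega)), rfl, rfl⟩
  have hr' : r' ≤ 3 := by
    rcases h' with h | h | h | h <;> omega
  rcases h with ⟨rfl, h1, h2, rfl, rfl⟩ | ⟨rfl, h1, h2, h3, h4, h5, rfl, rfl⟩ |
      ⟨rfl, D, E, h1, h2, h3, h4, h5, rfl, rfl, rfl, rfl⟩ | ⟨rfl, h0, D, h1, h2, rfl, rfl, rfl⟩
  · exact hs.trans hT0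
  · intro y hy
    by_cases hyx : y = 2 * t + 1
    · rw [hyx]; exact hT1 (by omega)
    · exact hT0 (hs (Finset.mem_erase.2 ⟨hyx, hy⟩))
  · obtain ⟨D', hD', rfl, rfl⟩ := hT2 (by omega)
    intro y hy
    rw [Finset.mem_sdiff] at hy ⊢
    refine ⟨hy.1, fun hyD => ?_⟩
    have hyx : y ≠ 2 * t + 1 := fun e => hy.2 (e ▸ h1 h3)
    have hy2 := Finset.mem_Icc.1 (hD' hyD)
    have := hs (Finset.mem_sdiff.2 ⟨Finset.mem_Icc.2 ⟨hy2.1, by omega⟩, hy.2⟩)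
    exact (Finset.mem_sdiff.1 this).2 hyD
  · rcases h' with h' | h' | h' | ⟨_, _, D', g1, g2, rfl, rfl, rfl⟩
    · omega
    · omega
    · omega
    · have hDD : D' ⊆ D := by
        intro y hy
        by_contra hyD
        exact (Finset.mem_sdiff.1 (hs (Finset.mem_sdiff.2 ⟨g1 hy, hyD⟩))).2 hy
      rw [Finset.eq_of_subset_of_card_le hDD (by omega)]
      exact h0

/-- The family `F` contains no induced copy of `(binom(2t,t)+1) C_2`. -/
theorem famF_free (t n : ℕ) (ht : 1 ≤ t) (hn : 2 * t + 2 ≤ n) :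
    ¬ ∃ B T : Fin ((2 * t).choose t + 1) → Finset ℕ,
      (∀ i, B i ∈ famF t n ∧ T i ∈ famF t n) ∧
      (∀ i, B i ⊂ T i) ∧
      (∀ i j, i ≠ j → ¬ B i ⊆ T j) := by
  rintro ⟨B, T, hF, hBT, hind⟩
  have hpos : 0 < (2 * t).choose t := Nat.choose_pos (by omega)
  have hnt : Nontrivial (Fin ((2 * t).choose t + 1)) := Fin.nontrivial_iff_two_le.2 (by omega)
  have hsubn : ∀ F ∈ famF t n, F ⊆ Finset.Icc 1 n := by
    rintro F (h | ⟨E, _, rfl⟩)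
    · rcases famF0_cases h with rfl | h
      · simp
      · exact h.1.trans (Finset.Icc_subset_Icc le_rfl (by omega))
    · exact Finset.sdiff_subset
  have hk : ∀ i, ∃ r a u, Kind t n (B i) (T i) r a u := by
    intro i
    obtain ⟨j, hj⟩ := exists_ne i
    refine exists_kind hn (hF i).1 (hF i).2 (hBT i) (fun h => ?_) (fun h => ?_)
    · exact hind i j hj.symm (by rw [h]; simp)
    · exact hind j i hj (by rw [h]; exact hsubn _ (hF j).1)
  choose r a u hk using hk
  have hp := fun i => (hk i).props ht
  have := comb_bound (t := t) (Finset.Icc 1 (2 * t)) a u r (fun i => (hp i).1)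
    (fun i => (hp i).2.1) (fun i => by have := hp i; omega) (fun i => by have := hp i; omega)
    (fun i => by have := hp i; omega)
    (fun i j hij hr hs => by
      rcases (hk i).pair hn ht (hk j) (hBT j).subset hr hs with h | ⟨h, h'⟩
      · exact absurd h (hind i j hij)
      · exact ⟨(hp i).2.2.2.2.2.2.2.1 h, (hp j).2.2.2.2.2.2.2.2 h'⟩)
  simp at this
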